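/- arXiv:2109.08929 — 2 statements merged into one kernel-verified Lean document; each statement's English description precedes it below -/
import Mathlib

section
/- Let 2 < α < 3. Then for every x ∈ ℝ with |x| ≠ 1, ∫_{−1}^{1} sgn(x−y) |x−y|^{α−3} (1−y²)^{−(α−1)/2} dy = 0 if |x| < 1, and = C_α · sgn(x) · (x²−1)^{−(3−α)/2} if |x| > 1, where C_α = √π Γ((3-α)/2)/Γ((4-α)/2). -/
open MeasureTheory Real

/-- Change of variables in an integral over `(-1, 1)` along a differentiable bijection of this
interval, whose inverse is given explicitly. -/
theorem integral_neg_one_one_eq_of_invOn {f f' g h : ℝ → ℝ}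
    (hf : Set.MapsTo f (Set.Ioo (-1) 1) (Set.Ioo (-1) 1))
    (hg : Set.MapsTo g (Set.Ioo (-1) 1) (Set.Ioo (-1) 1))
    (hfg : Set.InvOn g f (Set.Ioo (-1) 1) (Set.Ioo (-1) 1))
    (hd : ∀ t ∈ Set.Ioo (-1 : ℝ) 1, HasDerivAt f (f' t) t) :
    ∫ y in (-1 : ℝ)..1, h y = ∫ t in (-1 : ℝ)..1, |f' t| * h (f t) := by
  have hb : Set.BijOn f (Set.Ioo (-1) 1) (Set.Ioo (-1) 1) := hfg.bijOn hf hg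
  have key := integral_image_eq_integral_abs_deriv_smul measurableSet_Ioo
    (fun t ht => (hd t ht).hasDerivWithinAt) hb.injOn h
  rw [hb.image_eq] at key
  rw [intervalIntegral.integral_of_le (by norm_num), intervalIntegral.integral_of_le (by norm_num),
    integral_Ioc_eq_integral_Ioo, integral_Ioc_eq_integral_Ioo, key]
  rfl

/-- Two integrands over `(-1, 1)` that agree in the open interval have the same integral. -/
theorem integral_neg_one_one_congr {f g : ℝ → ℝ} (h : ∀ y ∈ Set.Ioo (-1 : ℝ) 1, f y = g y) :
    ∫ y in (-1 : ℝ)..1, f y = ∫ y in (-1 : ℝ)..1, g y := by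
  rw [intervalIntegral.integral_of_le (by norm_num), intervalIntegral.integral_of_le (by norm_num),
    integral_Ioc_eq_integral_Ioo, integral_Ioc_eq_integral_Ioo]
  exact setIntegral_congr_fun measurableSet_Ioo h

/-- The Euler beta integral over the unit interval, for real parameters. -/
theorem integral_rpow_mul_one_sub_rpow {a b : ℝ} (ha : 0 < a) (hb : 0 < b) :
    ∫ u in (0 : ℝ)..1, u ^ (a - 1) * (1 - u) ^ (b - 1) = ProbabilityTheory.beta a b := by
  have h : Complex.betaIntegral a b =
      ((∫ u in (0 : ℝ)..1, u ^ (a - 1) * (1 - u) ^ (b - 1) : ℝ) : ℂ) := by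
    rw [Complex.betaIntegral, ← intervalIntegral.integral_ofReal]
    refine intervalIntegral.integral_congr fun u hu => ?_
    rw [Set.uIcc_of_le zero_le_one] at hu
    push_cast
    rw [Complex.ofReal_cpow hu.1, Complex.ofReal_cpow (sub_nonneg.2 hu.2)]
    push_cast
    rfl
  rw [ProbabilityTheory.beta_eq_betaIntegralReal a b ha hb, h, Complex.ofReal_re]

/-- The integral of the Gegenbauer weight `(1 - t²)^(a - 1)`. -/
theorem integral_one_sub_sq_rpow {a : ℝ} (ha : 0 < a) :
    ∫ t in (-1 : ℝ)..1, (1 - t ^ 2) ^ (a - 1) = √π * Gamma a / Gamma (a + 1 / 2) := by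
  have h := intervalIntegral.integral_comp_mul_sub (a := 0) (b := 1)
    (fun t : ℝ => (1 - t ^ 2) ^ (a - 1)) two_ne_zero 1
  norm_num at h
  have h' : ∫ u in (0 : ℝ)..1, (1 - (2 * u - 1) ^ 2) ^ (a - 1) =
      4 ^ (a - 1) * ProbabilityTheory.beta a a := by
    rw [← integral_rpow_mul_one_sub_rpow ha ha, ← intervalIntegral.integral_const_mul]
    refine intervalIntegral.integral_congr fun u hu => ?_
    rw [Set.uIcc_of_le zero_le_one] at hu
    rw [← mul_rpow hu.1 (sub_nonneg.2 hu.2), ← mul_rpow (by norm_num)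
      (mul_nonneg hu.1 (sub_nonneg.2 hu.2))]
    ring_nf
  have h4 : (4 : ℝ) ^ (a - 1) * 2 * 2 ^ (1 - 2 * a) = 1 := by
    rw [show (4 : ℝ) = 2 ^ (2 : ℝ) by norm_num, ← rpow_mul two_pos.le, ← rpow_add_one two_ne_zero,
      ← rpow_add two_pos, show 2 * (a - 1) + 1 + (1 - 2 * a) = 0 by ring, rpow_zero]
  have hG := Gamma_mul_Gamma_add_half a
  have h1 : Gamma (a + 1 / 2) ≠ 0 := (Gamma_pos_of_pos (by linarith)).ne'
  have h2 : Gamma (2 * a) ≠ 0 := (Gamma_pos_of_pos (by linarith)).ne'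
  have h3 : ∫ t in (-1 : ℝ)..1, (1 - t ^ 2) ^ (a - 1) =
      2 * (4 ^ (a - 1) * ProbabilityTheory.beta a a) := by
    rw [← h', h]; ring
  rw [h3, ProbabilityTheory.beta, ← two_mul, eq_div_iff h1]
  generalize Gamma (a + 1 / 2) = G at hG
  field_simp
  linear_combination 2 * (4 : ℝ) ^ (a - 1) * hG
    + √π * Gamma (2 * a) * h4

/-- The finite Hilbert-type transform vanishes inside the interval: the integrand is odd under the
Möbius involution of `(-1, 1)` that fixes `x` and exchanges the end points. -/
theorem integral_sign_abs_rpow_of_abs_lt_one {a x : ℝ} (hx : |x| < 1) :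
    ∫ y in (-1 : ℝ)..1, Real.sign (x - y) * |x - y| ^ (-(2 * a)) * (1 - y ^ 2) ^ (a - 1) = 0 := by
  obtain ⟨hx1, hx2⟩ := abs_lt.1 hx
  have hP : 0 < 1 - x ^ 2 := by nlinarith
  obtain ⟨D, hDe⟩ : ∃ D : ℝ → ℝ, ∀ y, D y = 1 + x ^ 2 - 2 * x * y := ⟨_, fun _ => rfl⟩
  have hD : ∀ y ∈ Set.Ioo (-1 : ℝ) 1, 0 < D y := by
    rintro y ⟨h1, h2⟩
    rw [hDe]
    nlinarith [sq_nonneg (x - y)]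
  set f : ℝ → ℝ := fun y => (2 * x - (1 + x ^ 2) * y) / D y with hf
  have hmaps : Set.MapsTo f (Set.Ioo (-1) 1) (Set.Ioo (-1) 1) := by
    intro y hy
    have hDy := hD y hy
    constructor
    · rw [hf]
      simp only
      rw [lt_div_iff₀ hDy, hDe]
      nlinarith [mul_pos (pow_pos (by linarith : 0 < 1 + x) 2) (sub_pos.2 hy.2)]
    · rw [hf]
      simp only
      rw [div_lt_iff₀ hDy, hDe]
      nlinarith [mul_pos (pow_pos (by linarith : 0 < 1 - x) 2) (by linarith [hy.1] : 0 < 1 + y)]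
  have hinv : Set.LeftInvOn f f (Set.Ioo (-1) 1) := by
    intro y hy
    have hDy := (hD y hy).ne'
    have e : D (f y) = (1 - x ^ 2) ^ 2 / D y := by
      rw [hDe]; simp only [hf]; field_simp; rw [hDe]; ring
    have e' : 2 * x - (1 + x ^ 2) * f y = (1 - x ^ 2) ^ 2 * y / D y := by
      simp only [hf]; field_simp; rw [hDe]; ring
    change (2 * x - (1 + x ^ 2) * f y) / D (f y) = y
    rw [e, e']
    field_simp
  have hderiv : ∀ y ∈ Set.Ioo (-1 : ℝ) 1,
      HasDerivAt f (-((1 - x ^ 2) / D y) ^ 2) y := by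
    intro y hy
    have hDy := (hD y hy).ne'
    have hn : HasDerivAt (fun y => 2 * x - (1 + x ^ 2) * y) (-((1 + x ^ 2) * 1)) y :=
      ((hasDerivAt_id y).const_mul _).const_sub _
    have hd : HasDerivAt D (-(2 * x * 1)) y := by
      rw [funext hDe]
      exact ((hasDerivAt_id y).const_mul _).const_sub _
    refine (hn.div hd hDy).congr_deriv ?_
    field_simp
    rw [hDe]
    ring
  have key := integral_neg_one_one_eq_of_invOn (h := fun y =>
    Real.sign (x - y) * |x - y| ^ (-(2 * a)) * (1 - y ^ 2) ^ (a - 1)) hmaps hmaps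
    ⟨hinv, hinv⟩ hderiv
  rw [integral_neg_one_one_congr (f := fun t => |_| * _) (g := fun y =>
    -(Real.sign (x - y) * |x - y| ^ (-(2 * a)) * (1 - y ^ 2) ^ (a - 1))),
    intervalIntegral.integral_neg] at key
  · linarith
  intro y hy
  have hDy := hD y hy
  obtain ⟨c, hc⟩ : ∃ c, c = (1 - x ^ 2) / D y := ⟨_, rfl⟩
  have hc0 : 0 < c := hc ▸ div_pos hP hDy
  have e1 : x - f y = -(c * (x - y)) := by
    rw [hc]; simp only [hf]; field_simp; rw [hDe]; ring
  have e2 : 1 - f y ^ 2 = c ^ 2 * (1 - y ^ 2) := by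
    rw [hc]; simp only [hf]; field_simp; rw [hDe]; ring
  have hy2 : 0 < 1 - y ^ 2 := by nlinarith [hy.1, hy.2]
  have hs : Real.sign (c * (x - y)) = Real.sign (x - y) := by
    rcases lt_trichotomy (x - y) 0 with h | h | h
    · rw [Real.sign_of_neg h, Real.sign_of_neg (mul_neg_of_pos_of_neg hc0 h)]
    · rw [h, mul_zero]
    · rw [Real.sign_of_pos h, Real.sign_of_pos (mul_pos hc0 h)]
  have hpow : c ^ 2 * (c ^ (-(2 * a)) * (c ^ 2) ^ (a - 1)) = 1 := by
    rw [← rpow_natCast c 2, ← rpow_mul hc0.le, ← rpow_add hc0, ← rpow_add hc0]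
    push_cast
    ring_nf
    exact rpow_zero c
  rw [← hc, abs_neg, abs_of_nonneg (sq_nonneg c), e1, e2, Real.sign_neg, hs, abs_neg, abs_mul,
    abs_of_pos hc0, mul_rpow hc0.le (abs_nonneg _), mul_rpow (sq_nonneg c) hy2.le]
  linear_combination -(Real.sign (x - y) * |x - y| ^ (-(2 * a)) * (1 - y ^ 2) ^ (a - 1)) * hpow

/-- The value outside the interval, by the Möbius transformation fixing `±1` and sending `∞`
to `x`. -/
theorem integral_sign_abs_rpow_of_one_lt {a x : ℝ} (ha : 0 < a) (hx : 1 < x) :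
    ∫ y in (-1 : ℝ)..1, Real.sign (x - y) * |x - y| ^ (-(2 * a)) * (1 - y ^ 2) ^ (a - 1) =
      √π * Gamma a / Gamma (a + 1 / 2) * (x ^ 2 - 1) ^ (-a) := by
  have hP : 0 < x ^ 2 - 1 := by nlinarith
  have hmaps : Set.MapsTo (fun t => (1 + x * t) / (t + x)) (Set.Ioo (-1) 1) (Set.Ioo (-1) 1) := by
    rintro t ⟨h1, h2⟩
    have hD : 0 < t + x := by linarith
    constructor
    · rw [lt_div_iff₀ hD]
      nlinarith
    · rw [div_lt_iff₀ hD]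
      nlinarith
  have hmaps' : Set.MapsTo (fun y => (x * y - 1) / (x - y)) (Set.Ioo (-1) 1) (Set.Ioo (-1) 1) := by
    rintro y ⟨h1, h2⟩
    have hD : 0 < x - y := by linarith
    constructor
    · rw [lt_div_iff₀ hD]
      nlinarith
    · rw [div_lt_iff₀ hD]
      nlinarith
  have hinv : Set.InvOn (fun y => (x * y - 1) / (x - y)) (fun t => (1 + x * t) / (t + x))
      (Set.Ioo (-1) 1) (Set.Ioo (-1) 1) := by
    constructor
    · rintro t ⟨h1, h2⟩
      have hD : t + x ≠ 0 := by linarith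
      have e : x - (1 + x * t) / (t + x) = (x ^ 2 - 1) / (t + x) := by field_simp; ring
      simp only
      rw [e]
      field_simp
      ring
    · rintro y ⟨h1, h2⟩
      have hD : x - y ≠ 0 := by linarith
      have e : (x * y - 1) / (x - y) + x = (x ^ 2 - 1) / (x - y) := by field_simp; ring
      simp only
      rw [e]
      field_simp
      ring
  have hderiv : ∀ t ∈ Set.Ioo (-1 : ℝ) 1,
      HasDerivAt (fun t => (1 + x * t) / (t + x)) ((x ^ 2 - 1) / (t + x) ^ 2) t := by
    rintro t ⟨h1, h2⟩
    have hD : t + x ≠ 0 := by linarith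
    have hn : HasDerivAt (fun t => 1 + x * t) (x * 1) t :=
      ((hasDerivAt_id t).const_mul _).const_add _
    have hd : HasDerivAt (fun t => t + x) 1 t := (hasDerivAt_id t).add_const _
    refine (hn.div hd hD).congr_deriv ?_
    field_simp
    ring
  rw [integral_neg_one_one_eq_of_invOn hmaps hmaps' hinv hderiv, ← integral_one_sub_sq_rpow ha,
    ← intervalIntegral.integral_mul_const]
  refine integral_neg_one_one_congr ?_
  rintro t ⟨h1, h2⟩
  have hD : 0 < t + x := by linarith
  have ht : 0 < 1 - t ^ 2 := by nlinarith
  have e1 : x - (1 + x * t) / (t + x) = (x ^ 2 - 1) * (t + x)⁻¹ := by field_simp; ring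
  have e2 : 1 - ((1 + x * t) / (t + x)) ^ 2 = (x ^ 2 - 1) * ((t + x)⁻¹ ^ 2 * (1 - t ^ 2)) := by
    field_simp; ring
  have e3 : (x ^ 2 - 1) / (t + x) ^ 2 = (x ^ 2 - 1) * (t + x)⁻¹ ^ 2 := by field_simp
  obtain ⟨c, hc⟩ : ∃ c, c = (t + x)⁻¹ := ⟨_, rfl⟩
  have hc0 : 0 < c := hc ▸ inv_pos.2 hD
  obtain ⟨P, hPx⟩ : ∃ P, P = x ^ 2 - 1 := ⟨_, rfl⟩
  rw [e1, e2, e3, ← hc, ← hPx]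
  rw [← hPx] at hP
  have hpow : c ^ 2 * (c ^ (-(2 * a)) * (c ^ 2) ^ (a - 1)) = 1 := by
    rw [← rpow_natCast c 2, ← rpow_mul hc0.le, ← rpow_add hc0, ← rpow_add hc0]
    push_cast
    ring_nf
    exact rpow_zero c
  have hpow' : P * (P ^ (-(2 * a)) * P ^ (a - 1)) = P ^ (-a) := by
    nth_rw 1 [← rpow_one P]
    rw [← rpow_add hP, ← rpow_add hP]
    ring_nf
  rw [Real.sign_of_pos (by positivity), abs_of_pos (by positivity), abs_of_pos (by positivity),
    mul_rpow hP.le hc0.le, mul_rpow hP.le (by positivity), mul_rpow (by positivity) ht.le, ← hpow']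
  linear_combination P * (P ^ (-(2 * a)) * P ^ (a - 1)) * (1 - t ^ 2) ^ (a - 1) * hpow

/-- equation (2.4). For `2 < α < 3` and `x ∈ ℝ` with `|x| ≠ 1`,
`∫_{-1}^{1} sgn(x-y) |x-y|^{α-3} (1-y²)^{-(α-1)/2} dy` equals `0` if `|x| < 1` and equals
`C_α sgn(x) (x²-1)^{-(3-α)/2}` if `|x| > 1`. -/
theorem integral_sign_abs_rpow_sub_three
    (α : ℝ) (hα2 : 2 < α) (hα3 : α < 3)
    (Cα : ℝ)
    (hC : Cα = Real.sqrt π * Real.Gamma ((3 - α) / 2) / Real.Gamma ((4 - α) / 2)) :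
    ∀ x : ℝ, |x| ≠ 1 →
      (∫ y in (-1 : ℝ)..1,
          Real.sign (x - y) * |x - y| ^ (α - 3) * (1 - y ^ 2) ^ (-(α - 1) / 2)) =
        if |x| < 1 then 0 else Cα * Real.sign x * (x ^ 2 - 1) ^ (-(3 - α) / 2) := by
  intro x hx
  obtain ⟨a, ha⟩ : ∃ a, a = (3 - α) / 2 := ⟨_, rfl⟩
  have ha0 : 0 < a := by linarith
  rw [show α - 3 = -(2 * a) by linarith, show -(α - 1) / 2 = a - 1 by linarith,
    show -(3 - α) / 2 = -a by linarith]
  rw [← ha, show (4 - α) / 2 = a + 1 / 2 by linarith] at hC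
  split_ifs with h
  · exact integral_sign_abs_rpow_of_abs_lt_one h
  rcases lt_abs.1 (lt_of_le_of_ne (not_lt.1 h) hx.symm) with h | h
  · rw [integral_sign_abs_rpow_of_one_lt ha0 h, hC, Real.sign_of_pos (by linarith), mul_one]
  · have key := integral_sign_abs_rpow_of_one_lt ha0 h
    have hneg := intervalIntegral.integral_comp_neg (a := -1) (b := 1) fun y : ℝ =>
      Real.sign (x - y) * |x - y| ^ (-(2 * a)) * (1 - y ^ 2) ^ (a - 1)
    rw [neg_neg] at hneg
    rw [← hneg, hC, Real.sign_of_neg (by linarith), ← neg_sq x, mul_neg_one, neg_mul, ← key,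
      ← intervalIntegral.integral_neg]
    refine intervalIntegral.integral_congr fun y _ => ?_
    rw [show x - -y = -(-x - y) by ring, Real.sign_neg, abs_neg, neg_sq]
    ring
end

section
/- Let 2 < α < 3. Then for every x ∈ ℝ with |x| ≠ 1, ∫_{−1}^{1} sgn(x−y) |x−y|^{α−1} (1−y²)^{−(α−1)/2} dy = (α−1) c_α x if |x| < 1, and = (α−1) c_α x + (α−1)(α−2) C_α sgn(x) ∫_{1}^{|x|} (z²−1)^{−(3−α)/2} (|x|−z) dz if |x| > 1, where c_α = π / sin((α−1)π/2) and C_α = √π Γ((3-α)/2)/Γ((4-α)/2). -/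
open MeasureTheory Real

open Set

/-- Change of variables along a differentiable bijection between subsets of the real line. -/
lemma setIntegral_eq_of_hasDerivAt_of_leftInverse {s t : Set ℝ} (hs : MeasurableSet s)
    {f f' g : ℝ → ℝ} (hf : MapsTo f s t) (hg : MapsTo g t s) (hgf : LeftInvOn g f s)
    (hfg : LeftInvOn f g t) (hf' : ∀ u ∈ s, HasDerivAt f (f' u) u) (φ : ℝ → ℝ) :
    ∫ u in t, φ u = ∫ u in s, |f' u| * φ (f u) := by
  have himage : f '' s = t :=
    Subset.antisymm hf.image_subset fun u hu => ⟨g u, hg hu, hfg hu⟩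
  rw [← himage, integral_image_eq_integral_abs_deriv_smul hs
    (fun u hu => (hf' u hu).hasDerivWithinAt) hgf.injOn]
  simp only [smul_eq_mul]

lemma setIntegral_rpow_mul_one_sub_rpow {a b : ℝ} (ha : 0 < a) (hb : 0 < b) :
    ∫ u in Ioo (0 : ℝ) 1, u ^ (a - 1) * (1 - u) ^ (b - 1) =
      Gamma a * Gamma b / Gamma (a + b) := by
  change _ = ProbabilityTheory.beta a b
  have hconv : IntegrableOn (fun u : ℝ => (u : ℂ) ^ ((a : ℂ) - 1) * (1 - u : ℂ) ^ ((b : ℂ) - 1))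
      (Ioc 0 1) := by
    rw [← intervalIntegrable_iff_integrableOn_Ioc_of_le zero_le_one]
    exact Complex.betaIntegral_convergent (by simpa using ha) (by simpa using hb)
  rw [ProbabilityTheory.beta_eq_betaIntegralReal a b ha hb, Complex.betaIntegral,
    intervalIntegral.integral_of_le zero_le_one, ← integral_Ioc_eq_integral_Ioo,
    ← RCLike.re_to_complex, ← integral_re hconv]
  refine setIntegral_congr_fun measurableSet_Ioc fun u ⟨hu0, hu1⟩ => ?_
  norm_cast
  rw [← Complex.ofReal_cpow hu0.le, ← Complex.ofReal_cpow (by linarith), RCLike.re_to_complex,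
    Complex.re_mul_ofReal, Complex.ofReal_re]

lemma setIntegral_abs_mul_comp_sq (φ : ℝ → ℝ) :
    ∫ v in Ioo (-1 : ℝ) 1, |v| * φ (v ^ 2) = ∫ u in Ioo (0 : ℝ) 1, φ u := by
  have habs := integral_comp_abs (f := (Iio (1 : ℝ)).indicator fun v => v * φ (v ^ 2))
  have hpow := integral_comp_rpow_Ioi_of_pos (g := (Iio (1 : ℝ)).indicator φ) two_pos
  rw [setIntegral_indicator measurableSet_Iio, Ioi_inter_Iio] at hpow
  rw [← hpow, ← integral_indicator measurableSet_Ioo]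
  calc _ = ∫ v, (Iio (1 : ℝ)).indicator (fun v => v * φ (v ^ 2)) |v| := by
        congr with v
        simp only [indicator, mem_Ioo, mem_Iio, abs_lt, sq_abs]
    _ = _ := by
        rw [habs, ← integral_const_mul]
        refine setIntegral_congr_fun measurableSet_Ioi fun v hv => ?_
        have hv : 0 < v := hv
        have : v ^ 2 < 1 ↔ v < 1 := by
          rw [sq_lt_one_iff₀ hv.le]
        norm_num [indicator, this]
        split_ifs <;> ring

lemma integrableOn_one_sub_sq_rpow {r : ℝ} (hr : -1 < r) (hr0 : r ≤ 0) :
    IntegrableOn (fun y : ℝ => (1 - y ^ 2) ^ r) (Ioo (-1) 1) := by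
  have hleft : IntegrableOn (fun y : ℝ => (1 - y) ^ r) (Ioo (-1) 1) := by
    rw [← integrableOn_Ioc_iff_integrableOn_Ioo,
      ← intervalIntegrable_iff_integrableOn_Ioc_of_le (by norm_num)]
    have := (intervalIntegral.intervalIntegrable_rpow' (a := 2) (b := 0) hr).comp_sub_left 1
    norm_num at this
    exact this
  have hright : IntegrableOn (fun y : ℝ => (1 + y) ^ r) (Ioo (-1) 1) := by
    rw [← integrableOn_Ioc_iff_integrableOn_Ioo,
      ← intervalIntegrable_iff_integrableOn_Ioc_of_le (by norm_num)]
    have := (intervalIntegral.intervalIntegrable_rpow' (a := 0) (b := 2) hr).comp_add_left 1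
    norm_num at this
    exact this
  refine (hleft.add hright).mono' (Measurable.aestronglyMeasurable (by fun_prop)) ?_
  refine (ae_restrict_iff' measurableSet_Ioo).2 (.of_forall fun y ⟨hy0, hy1⟩ => ?_)
  have h0 : 0 < 1 - y := by linarith
  have h1 : 0 < 1 + y := by linarith
  have h2 : 0 < 1 - y ^ 2 := by nlinarith
  rw [norm_of_nonneg (by positivity)]
  simp only [Pi.add_apply]
  rcases le_total 0 y with hy | hy
  · have := rpow_le_rpow_of_nonpos h0 (by nlinarith : 1 - y ≤ 1 - y ^ 2) hr0
    have := rpow_nonneg h1.le r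
    linarith
  · have := rpow_le_rpow_of_nonpos h1 (by nlinarith : 1 + y ≤ 1 - y ^ 2) hr0
    have := rpow_nonneg h0.le r
    linarith

lemma setIntegral_one_sub_sq_rpow {β : ℝ} (hβ : β < 2) :
    ∫ y in Ioo (-1 : ℝ) 1, (1 - y ^ 2) ^ (-β / 2) =
      √π * Gamma ((2 - β) / 2) / Gamma ((3 - β) / 2) := by
  have h := setIntegral_rpow_mul_one_sub_rpow (a := 1 / 2) (b := (2 - β) / 2) (by norm_num)
    (by linarith)
  rw [Gamma_one_half_eq, show 1 / 2 + (2 - β) / 2 = (3 - β) / 2 by ring] at h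
  rw [← h, ← setIntegral_abs_mul_comp_sq]
  refine setIntegral_congr_ae measurableSet_Ioo ?_
  filter_upwards [compl_mem_ae_iff.2 (measure_singleton (0 : ℝ))] with y hy _
  have hy : 0 < |y| := abs_pos.2 hy
  rw [← sq_abs y, ← rpow_natCast, ← rpow_mul hy.le, ← mul_assoc]
  norm_num
  rw [rpow_neg_one, mul_inv_cancel₀ hy.ne', one_mul]
  ring_nf

lemma mul_rpow_mobius_exterior {A P D β : ℝ} (hA : 0 < A) (hP : 0 < P) (hD : 0 < D) :
    A / D ^ 2 * ((A / D) ^ (β - 2) * (A * P / D ^ 2) ^ (-β / 2)) =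
      A ^ (-(2 - β) / 2) * P ^ (-β / 2) := by
  obtain ⟨a, rfl⟩ : ∃ a, exp a = A := ⟨_, exp_log hA⟩
  obtain ⟨p, rfl⟩ : ∃ a, exp a = P := ⟨_, exp_log hP⟩
  obtain ⟨d, rfl⟩ : ∃ a, exp a = D := ⟨_, exp_log hD⟩
  simp only [← exp_nat_mul, ← exp_add, ← exp_sub, ← exp_mul]
  congr 1
  push_cast
  ring

lemma mul_rpow_mobius_interior {A P D V β : ℝ} (hA : 0 < A) (hP : 0 < P) (hD : 0 < D)
    (hV : 0 ≤ V) :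
    A / D ^ 2 * ((V * (A / D)) ^ (β - 1) * (A * P / D ^ 2) ^ (-β / 2)) =
      A ^ (β / 2) * (V ^ (β - 1) * P ^ (-β / 2) / D) := by
  rw [mul_rpow hV (by positivity)]
  obtain ⟨a, rfl⟩ : ∃ a, exp a = A := ⟨_, exp_log hA⟩
  obtain ⟨p, rfl⟩ : ∃ a, exp a = P := ⟨_, exp_log hP⟩
  obtain ⟨d, rfl⟩ : ∃ a, exp a = D := ⟨_, exp_log hD⟩
  generalize V ^ (β - 1) = W
  suffices exp a / exp d ^ 2 * ((exp a / exp d) ^ (β - 1) *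
      (exp a * exp p / exp d ^ 2) ^ (-β / 2)) =
      exp a ^ (β / 2) * (exp p ^ (-β / 2) / exp d) by
    linear_combination W * this
  simp only [← exp_nat_mul, ← exp_add, ← exp_sub, ← exp_mul]
  congr 1
  push_cast
  ring

lemma mul_rpow_mobius_unit {M P Q D β : ℝ} (hM : 0 < M) (hP : 0 < P) (hQ : 0 < Q) (hD : 0 < D) :
    M / D ^ 2 * ((P / D) ^ (β / 2 - 1) * (M * Q / D) ^ (-β / 2) / (M / D)) =
      M ^ (-β / 2) * (P ^ (β / 2 - 1) * Q ^ (-β / 2)) := by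
  obtain ⟨a, rfl⟩ : ∃ a, exp a = M := ⟨_, exp_log hM⟩
  obtain ⟨p, rfl⟩ : ∃ a, exp a = P := ⟨_, exp_log hP⟩
  obtain ⟨q, rfl⟩ : ∃ a, exp a = Q := ⟨_, exp_log hQ⟩
  obtain ⟨d, rfl⟩ : ∃ a, exp a = D := ⟨_, exp_log hD⟩
  simp only [← exp_nat_mul, ← exp_add, ← exp_sub, ← exp_mul]
  congr 1
  push_cast
  ring

/-- The involution `t ↦ (1 - x t) / (x - t)` of `(-1, 1)` evaluates the integral outside. -/
lemma setIntegral_sub_rpow_mul_one_sub_sq_rpow {β x : ℝ} (hx : 1 < x) :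
    ∫ y in Ioo (-1 : ℝ) 1, (x - y) ^ (β - 2) * (1 - y ^ 2) ^ (-β / 2) =
      (x ^ 2 - 1) ^ (-(2 - β) / 2) * ∫ y in Ioo (-1 : ℝ) 1, (1 - y ^ 2) ^ (-β / 2) := by
  have hA : 0 < x ^ 2 - 1 := by nlinarith
  have hmaps : MapsTo (fun t => (1 - x * t) / (x - t)) (Ioo (-1) 1) (Ioo (-1) 1) := by
    rintro t ⟨ht0, ht1⟩
    have hD : 0 < x - t := by linarith
    exact ⟨by rw [lt_div_iff₀ hD]; nlinarith, by rw [div_lt_iff₀ hD]; nlinarith⟩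
  have hinv : LeftInvOn (fun t => (1 - x * t) / (x - t)) (fun t => (1 - x * t) / (x - t))
      (Ioo (-1) 1) := by
    rintro t ⟨ht0, ht1⟩
    have hD : x - t ≠ 0 := by linarith
    have hA' : x * (x - t) - (1 - x * t) ≠ 0 := by
      rw [show x * (x - t) - (1 - x * t) = x ^ 2 - 1 by ring]; exact hA.ne'
    field_simp
    ring
  rw [setIntegral_eq_of_hasDerivAt_of_leftInverse (f' := fun t => -((x ^ 2 - 1) / (x - t) ^ 2))
    measurableSet_Ioo hmaps hmaps hinv hinv, ← integral_const_mul]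
  · refine setIntegral_congr_fun measurableSet_Ioo ?_
    rintro t ⟨ht0, ht1⟩
    have hD : 0 < x - t := by linarith
    have hP : 0 < 1 - t ^ 2 := by nlinarith
    simp only
    rw [abs_neg, abs_of_pos (by positivity), ← mul_rpow_mobius_exterior hA hP hD,
      show x - (1 - x * t) / (x - t) = (x ^ 2 - 1) / (x - t) by field_simp; ring,
      show 1 - ((1 - x * t) / (x - t)) ^ 2 = (x ^ 2 - 1) * (1 - t ^ 2) / (x - t) ^ 2 by
        field_simp; ring]
  · rintro t ⟨ht0, ht1⟩
    have hD : x - t ≠ 0 := by linarith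
    convert! (((hasDerivAt_id t).const_mul x).const_sub 1).div ((hasDerivAt_id t).const_sub x) hD
      using 1
    simp only [id]
    field_simp
    ring

lemma setIntegral_unit_mobius {β m : ℝ} (hβ0 : 0 < β) (hβ2 : β < 2) (hm0 : 0 ≤ m) (hm1 : m < 1) :
    ∫ u in Ioo (0 : ℝ) 1, u ^ (β / 2 - 1) * (1 - u) ^ (-β / 2) / (1 - m * u) =
      (1 - m) ^ (-β / 2) * (π / sin (β * π / 2)) := by
  have hbeta := setIntegral_rpow_mul_one_sub_rpow (a := β / 2) (b := 1 - β / 2) (by linarith)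
    (by linarith)
  rw [Gamma_mul_Gamma_one_sub, add_sub_cancel, Gamma_one, div_one,
    show π * (β / 2) = β * π / 2 by ring, show 1 - β / 2 - 1 = -β / 2 by ring] at hbeta
  have hM : 0 < 1 - m := by linarith
  have hf : MapsTo (fun p => p / (1 - m + m * p)) (Ioo (0 : ℝ) 1) (Ioo 0 1) := by
    rintro p ⟨hp0, hp1⟩
    have hD : 0 < 1 - m + m * p := by positivity
    exact ⟨by positivity, by rw [div_lt_one hD]; nlinarith⟩
  have hg : MapsTo (fun u => (1 - m) * u / (1 - m * u)) (Ioo (0 : ℝ) 1) (Ioo 0 1) := by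
    rintro u ⟨hu0, hu1⟩
    have hD : 0 < 1 - m * u := by nlinarith
    exact ⟨by positivity, by rw [div_lt_one hD]; nlinarith⟩
  have hgf : LeftInvOn (fun u => (1 - m) * u / (1 - m * u)) (fun p => p / (1 - m + m * p))
      (Ioo (0 : ℝ) 1) := by
    rintro p ⟨hp0, hp1⟩
    have hD : 1 - m + m * p ≠ 0 := by positivity
    have hE : 1 - m + m * p - m * p ≠ 0 := by
      rw [add_sub_cancel_right]; exact hM.ne'
    field_simp
    ring
  have hfg : LeftInvOn (fun p => p / (1 - m + m * p)) (fun u => (1 - m) * u / (1 - m * u))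
      (Ioo (0 : ℝ) 1) := by
    rintro u ⟨hu0, hu1⟩
    have hD : 1 - m * u ≠ 0 := by nlinarith
    have hE : (1 - m) + m * ((1 - m) * u / (1 - m * u)) ≠ 0 := by
      rw [show (1 - m) + m * ((1 - m) * u / (1 - m * u)) = (1 - m) / (1 - m * u) by
        field_simp; ring]
      exact div_ne_zero hM.ne' hD
    simp only
    rw [div_eq_iff hE]
    field_simp
    ring
  rw [setIntegral_eq_of_hasDerivAt_of_leftInverse
    (f' := fun p => (1 - m) / (1 - m + m * p) ^ 2) measurableSet_Ioo hf hg hgf hfg, ← hbeta,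
    ← integral_const_mul]
  · refine setIntegral_congr_fun measurableSet_Ioo ?_
    rintro p ⟨hp0, hp1⟩
    have hD : 0 < 1 - m + m * p := by positivity
    have hQ : 0 < 1 - p := by linarith
    simp only
    rw [abs_of_pos (by positivity), ← mul_rpow_mobius_unit hM hp0 hQ hD,
      show 1 - p / (1 - m + m * p) = (1 - m) * (1 - p) / (1 - m + m * p) by field_simp; ring,
      show 1 - m * (p / (1 - m + m * p)) = (1 - m) / (1 - m + m * p) by field_simp; ring]
  · rintro p ⟨hp0, hp1⟩
    have hD : 1 - m + m * p ≠ 0 := by positivity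
    convert! (hasDerivAt_id p).div (((hasDerivAt_id p).const_mul m).const_add (1 - m)) hD using 1
    simp only [id]
    field_simp
    ring

/-- Averaging an integral of an even function against `(1 - x v)⁻¹` over `v ↦ -v`. -/
lemma setIntegral_even_div_one_sub_mul {E : ℝ → ℝ} (hE : IntegrableOn E (Ioo (-1) 1))
    (heven : ∀ v, E (-v) = E v) {x : ℝ} (hx : |x| < 1) :
    ∫ v in Ioo (-1 : ℝ) 1, E v / (1 - x * v) =
      ∫ v in Ioo (-1 : ℝ) 1, E v / (1 - x ^ 2 * v ^ 2) := by
  obtain ⟨hx0, hx1⟩ := abs_lt.1 hx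
  have hpos : ∀ z : ℝ, |z| < 1 → ∀ v ∈ Ioo (-1 : ℝ) 1, 1 - |z| ≤ 1 - z * v := by
    intro z hz v hv
    have hv : |v| < 1 := abs_lt.2 hv
    have : z * v ≤ |z| * |v| := (le_abs_self _).trans_eq (abs_mul z v)
    nlinarith [abs_nonneg z]
  have hint : ∀ z : ℝ, |z| < 1 → IntegrableOn (fun v => E v / (1 - z * v)) (Ioo (-1) 1) := by
    intro z hz
    simp only [div_eq_mul_inv]
    refine Integrable.mul_bdd (c := (1 - |z|)⁻¹) hE
      (Measurable.aestronglyMeasurable (by fun_prop)) ?_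
    refine (ae_restrict_iff' measurableSet_Ioo).2 (.of_forall fun v hv => ?_)
    have := hpos z hz v hv
    rw [norm_of_nonneg (inv_nonneg.2 (by linarith))]
    exact inv_anti₀ (by linarith) this
  have hneg : ∫ v in Ioo (-1 : ℝ) 1, E v / (1 - x * v) =
      ∫ v in Ioo (-1 : ℝ) 1, E v / (1 - -x * v) := by
    rw [← integral_Ioc_eq_integral_Ioo, ← integral_Ioc_eq_integral_Ioo,
      ← intervalIntegral.integral_of_le (by norm_num),
      ← intervalIntegral.integral_of_le (by norm_num)]
    have := intervalIntegral.integral_comp_neg (a := -1) (b := 1) fun v => E v / (1 - x * v)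
    rw [neg_neg] at this
    rw [← this]
    simp only [heven, mul_neg, neg_mul]
  have hsum : ∫ v in Ioo (-1 : ℝ) 1, E v / (1 - x * v) =
      ∫ v in Ioo (-1 : ℝ) 1, (E v / (1 - x * v) + E v / (1 - -x * v)) / 2 := by
    rw [integral_div, integral_add (hint x hx) (hint (-x) (by rwa [abs_neg])), ← hneg]
    ring
  rw [hsum]
  refine setIntegral_congr_fun measurableSet_Ioo fun v hv => ?_
  have h1 := hpos x hx v hv
  have h2 := hpos (-x) (by rwa [abs_neg]) v hv
  rw [abs_neg] at h2
  have h3 : 1 - x * v ≠ 0 := by linarith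
  have h4 : 1 + x * v ≠ 0 := by linarith
  have h5 : 1 - x ^ 2 * v ^ 2 ≠ 0 := by
    rw [show 1 - x ^ 2 * v ^ 2 = (1 - x * v) * (1 + x * v) by ring]
    exact mul_ne_zero h3 h4
  rw [neg_mul, sub_neg_eq_add]
  field_simp
  ring

/-- The involution `v ↦ (x - v) / (1 - x v)` of `(-1, 1)` evaluates the integral inside. -/
lemma setIntegral_abs_sub_rpow_mul_one_sub_sq_rpow_of_abs_lt_one {β x : ℝ} (hβ1 : 1 < β)
    (hβ2 : β < 2) (hx : |x| < 1) :
    ∫ y in Ioo (-1 : ℝ) 1, |x - y| ^ (β - 1) * (1 - y ^ 2) ^ (-β / 2) =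
      π / sin (β * π / 2) := by
  obtain ⟨hx0, hx1⟩ := abs_lt.1 hx
  have hA : 0 < 1 - x ^ 2 := by nlinarith
  have hden : ∀ v ∈ Ioo (-1 : ℝ) 1, 0 < 1 - x * v := by
    rintro v ⟨hv0, hv1⟩
    nlinarith
  have hmaps : MapsTo (fun v => (x - v) / (1 - x * v)) (Ioo (-1) 1) (Ioo (-1) 1) := by
    intro v hv
    have hD := hden v hv
    obtain ⟨hv0, hv1⟩ := hv
    exact ⟨by rw [lt_div_iff₀ hD]; nlinarith, by rw [div_lt_iff₀ hD]; nlinarith⟩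
  have hinv : LeftInvOn (fun v => (x - v) / (1 - x * v)) (fun v => (x - v) / (1 - x * v))
      (Ioo (-1) 1) := by
    intro v hv
    have hD := (hden v hv).ne'
    have hA' : 1 - x * v - x * (x - v) ≠ 0 := by
      rw [show 1 - x * v - x * (x - v) = 1 - x ^ 2 by ring]; exact hA.ne'
    field_simp
    ring
  have hE : IntegrableOn (fun v : ℝ => |v| ^ (β - 1) * (1 - v ^ 2) ^ (-β / 2)) (Ioo (-1) 1) := by
    refine Integrable.bdd_mul (c := 1) (integrableOn_one_sub_sq_rpow (by linarith) (by linarith))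
      (Measurable.aestronglyMeasurable (by fun_prop)) ?_
    refine (ae_restrict_iff' measurableSet_Ioo).2 (.of_forall fun v hv => ?_)
    rw [norm_of_nonneg (by positivity)]
    exact rpow_le_one (abs_nonneg v) (abs_lt.2 hv).le (by linarith)
  rw [setIntegral_eq_of_hasDerivAt_of_leftInverse
    (f' := fun v => -((1 - x ^ 2) / (1 - x * v) ^ 2)) measurableSet_Ioo hmaps hmaps hinv hinv]
  · calc _ = ∫ v in Ioo (-1 : ℝ) 1,
          (1 - x ^ 2) ^ (β / 2) * (|v| ^ (β - 1) * (1 - v ^ 2) ^ (-β / 2) / (1 - x * v)) := by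
          refine setIntegral_congr_fun measurableSet_Ioo fun v hv => ?_
          have hD := hden v hv
          obtain ⟨hv0, hv1⟩ := hv
          have hP : 0 < 1 - v ^ 2 := by nlinarith
          rw [abs_neg, abs_of_pos (by positivity),
            ← mul_rpow_mobius_interior hA hP hD (abs_nonneg v),
            show x - (x - v) / (1 - x * v) = v * ((1 - x ^ 2) / (1 - x * v)) by field_simp; ring,
            abs_mul, abs_of_pos (div_pos hA hD),
            show 1 - ((x - v) / (1 - x * v)) ^ 2 = (1 - x ^ 2) * (1 - v ^ 2) / (1 - x * v) ^ 2 by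
              field_simp; ring]
      _ = (1 - x ^ 2) ^ (β / 2) * ∫ v in Ioo (-1 : ℝ) 1,
          |v| ^ (β - 1) * (1 - v ^ 2) ^ (-β / 2) / (1 - x ^ 2 * v ^ 2) := by
          rw [integral_const_mul, setIntegral_even_div_one_sub_mul hE (by simp) hx]
      _ = (1 - x ^ 2) ^ (β / 2) * ∫ u in Ioo (0 : ℝ) 1,
          u ^ (β / 2 - 1) * (1 - u) ^ (-β / 2) / (1 - x ^ 2 * u) := by
          rw [← setIntegral_abs_mul_comp_sq]
          congr 1
          refine setIntegral_congr_ae measurableSet_Ioo ?_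
          filter_upwards [compl_mem_ae_iff.2 (measure_singleton (0 : ℝ))] with v hv _
          have hv : 0 < |v| := abs_pos.2 hv
          have hpow : |v| ^ (β - 1) = |v| * (v ^ 2) ^ (β / 2 - 1) := by
            rw [← sq_abs v, ← rpow_natCast, ← rpow_mul hv.le]
            nth_rw 2 [← rpow_one |v|]
            rw [← rpow_add hv]
            push_cast
            ring_nf
          rw [hpow]
          ring
      _ = π / sin (β * π / 2) := by
          rw [setIntegral_unit_mobius (by linarith) hβ2 (sq_nonneg x) (by linarith), ← mul_assoc,
            ← rpow_add hA]
          ring_nf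
          simp
  · intro v hv
    have hD := (hden v hv).ne'
    convert! ((hasDerivAt_id v).const_sub x).div (((hasDerivAt_id v).const_mul x).const_sub 1) hD
      using 1
    simp only [id]
    field_simp
    ring

lemma sign_mul_abs_rpow {β : ℝ} (hβ : β ≠ 0) (u : ℝ) :
    Real.sign u * |u| ^ β = u * |u| ^ (β - 1) := by
  rcases lt_trichotomy u 0 with hu | rfl | hu
  · have hu0 : u ≠ 0 := hu.ne
    rw [sign_of_neg hu, abs_of_neg hu, rpow_sub_one (neg_ne_zero.2 hu0)]
    field_simp
  · simp [hβ]
  · rw [sign_of_pos hu, abs_of_pos hu, rpow_sub_one hu.ne']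
    field_simp

lemma hasDerivAt_mul_abs_rpow {β : ℝ} (hβ : 1 < β) (u : ℝ) :
    HasDerivAt (fun u => u * |u| ^ (β - 1)) (β * |u| ^ (β - 1)) u := by
  have hpow : Continuous fun u : ℝ => |u| ^ (β - 1) :=
    continuous_abs.rpow_const fun _ => Or.inr (by linarith)
  refine hasDerivAt_of_hasDerivAt_of_ne' (g := fun u => β * |u| ^ (β - 1)) (x := 0)
    (fun y hy => ?_) (continuous_id.mul hpow).continuousAt (hpow.const_mul β).continuousAt u
  have hy' : 0 < |y| := abs_pos.2 hy
  convert! (hasDerivAt_id y).mul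
    ((hasDerivAt_abs hy).rpow_const (p := β - 1) (Or.inl hy'.ne')) using 1
  rw [rpow_sub_one hy'.ne' (β - 1), id, show y * (SignType.sign y * (β - 1) *
    (|y| ^ (β - 1) / |y|)) = (y * SignType.sign y) * (β - 1) * |y| ^ (β - 1) / |y| by ring,
    self_mul_sign]
  field_simp
  ring

lemma integrableOn_mul_one_sub_sq_rpow {β c : ℝ} (hβ0 : 0 ≤ β) (hβ2 : β < 2) {φ : ℝ → ℝ}
    (hφ : Measurable φ) (hc : ∀ y ∈ Ioo (-1 : ℝ) 1, |φ y| ≤ c) :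
    IntegrableOn (fun y => φ y * (1 - y ^ 2) ^ (-β / 2)) (Ioo (-1) 1) :=
  Integrable.bdd_mul (c := c) (integrableOn_one_sub_sq_rpow (by linarith) (by linarith))
    hφ.aestronglyMeasurable ((ae_restrict_iff' measurableSet_Ioo).2 (.of_forall hc))

/-- Differentiation under the integral sign against the weight `(1 - y²) ^ (-β / 2)`. -/
lemma hasDerivAt_setIntegral_mul_one_sub_sq_rpow {β x ε b c : ℝ} (hβ0 : 0 ≤ β) (hβ2 : β < 2)
    (hε : 0 < ε) {k k' : ℝ → ℝ} (hk : Measurable k) (hk' : Measurable k')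
    (hb : ∀ y ∈ Ioo (-1 : ℝ) 1, |k (x - y)| ≤ b)
    (hc : ∀ z ∈ Metric.ball x ε, ∀ y ∈ Ioo (-1 : ℝ) 1, |k' (z - y)| ≤ c)
    (hderiv : ∀ z ∈ Metric.ball x ε, ∀ y ∈ Ioo (-1 : ℝ) 1, HasDerivAt k (k' (z - y)) (z - y)) :
    HasDerivAt (fun z => ∫ y in Ioo (-1 : ℝ) 1, k (z - y) * (1 - y ^ 2) ^ (-β / 2))
      (∫ y in Ioo (-1 : ℝ) 1, k' (x - y) * (1 - y ^ 2) ^ (-β / 2)) x := by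
  refine (hasDerivAt_integral_of_dominated_loc_of_deriv_le
    (F := fun z y => k (z - y) * (1 - y ^ 2) ^ (-β / 2))
    (F' := fun z y => k' (z - y) * (1 - y ^ 2) ^ (-β / 2))
    (bound := fun y => c * (1 - y ^ 2) ^ (-β / 2)) (Metric.ball_mem_nhds x hε)
    (.of_forall fun z => Measurable.aestronglyMeasurable (by fun_prop))
    (integrableOn_mul_one_sub_sq_rpow hβ0 hβ2 (by fun_prop) hb)
    (Measurable.aestronglyMeasurable (by fun_prop)) ?_
    ((integrableOn_one_sub_sq_rpow (by linarith) (by linarith)).const_mul c) ?_).2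
  · refine (ae_restrict_iff' measurableSet_Ioo).2 (.of_forall fun y hy z hz => ?_)
    have hP : 0 ≤ 1 - y ^ 2 := by nlinarith [hy.1, hy.2]
    rw [norm_mul, norm_of_nonneg (rpow_nonneg hP _)]
    exact mul_le_mul_of_nonneg_right (hc z hz y hy) (rpow_nonneg hP _)
  · refine (ae_restrict_iff' measurableSet_Ioo).2 (.of_forall fun y hy z hz => ?_)
    exact ((hderiv z hz y hy).comp_sub_const z y).mul_const _

lemma hasDerivAt_setIntegral_mul_abs_sub_rpow {β : ℝ} (hβ1 : 1 < β) (hβ2 : β < 2) (x : ℝ) :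
    HasDerivAt (fun z => ∫ y in Ioo (-1 : ℝ) 1,
        (z - y) * |z - y| ^ (β - 1) * (1 - y ^ 2) ^ (-β / 2))
      (β * ∫ y in Ioo (-1 : ℝ) 1, |x - y| ^ (β - 1) * (1 - y ^ 2) ^ (-β / 2)) x := by
  have hbound : ∀ z ∈ Metric.ball x 1, ∀ y ∈ Ioo (-1 : ℝ) 1, |z - y| ≤ |x| + 2 := by
    intro z hz y hy
    rw [Metric.mem_ball, dist_eq] at hz
    have hy : |y| < 1 := abs_lt.2 hy
    have : |z - y| ≤ |z| + |y| := abs_sub z y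
    have : |z| - |x| ≤ |z - x| := abs_sub_abs_le_abs_sub z x
    linarith
  have hpow : ∀ z ∈ Metric.ball x 1, ∀ y ∈ Ioo (-1 : ℝ) 1,
      |z - y| ^ (β - 1) ≤ (|x| + 2) ^ (β - 1) := fun z hz y hy =>
    rpow_le_rpow (abs_nonneg _) (hbound z hz y hy) (by linarith)
  rw [← integral_const_mul]
  simp only [← mul_assoc]
  refine hasDerivAt_setIntegral_mul_one_sub_sq_rpow (k := fun u => u * |u| ^ (β - 1))
    (k' := fun u => β * |u| ^ (β - 1)) (b := (|x| + 2) * (|x| + 2) ^ (β - 1))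
    (c := β * (|x| + 2) ^ (β - 1)) (by linarith) hβ2 one_pos (by fun_prop) (by fun_prop)
    (fun y hy => ?_) (fun z hz y hy => ?_) fun z _ y _ => hasDerivAt_mul_abs_rpow hβ1 _
  · have hx := Metric.mem_ball_self (x := x) one_pos
    rw [abs_mul, abs_of_nonneg (rpow_nonneg (abs_nonneg _) _)]
    exact mul_le_mul (hbound x hx y hy) (hpow x hx y hy) (by positivity) (by positivity)
  · rw [abs_of_nonneg (by positivity)]
    exact mul_le_mul_of_nonneg_left (hpow z hz y hy) (by linarith)

lemma hasDerivAt_setIntegral_abs_sub_rpow {β x : ℝ} (hβ1 : 1 < β) (hβ2 : β < 2) (hx : 1 < x) :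
    HasDerivAt (fun z => ∫ y in Ioo (-1 : ℝ) 1, |z - y| ^ (β - 1) * (1 - y ^ 2) ^ (-β / 2))
      ((β - 1) * ∫ y in Ioo (-1 : ℝ) 1, (x - y) ^ (β - 2) * (1 - y ^ 2) ^ (-β / 2)) x := by
  have hpos : ∀ z ∈ Metric.ball x ((x - 1) / 2), ∀ y ∈ Ioo (-1 : ℝ) 1, (x - 1) / 2 ≤ z - y := by
    intro z hz y hy
    rw [Metric.mem_ball, dist_eq, abs_lt] at hz
    linarith [hy.2, hz.1]
  rw [← integral_const_mul]
  simp only [← mul_assoc]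
  refine hasDerivAt_setIntegral_mul_one_sub_sq_rpow (k := fun u => |u| ^ (β - 1))
    (k' := fun u => (β - 1) * u ^ (β - 2)) (ε := (x - 1) / 2) (b := (x + 1) ^ (β - 1))
    (c := (β - 1) * ((x - 1) / 2) ^ (β - 2)) (by linarith) hβ2 (by linarith) (by fun_prop)
    (by fun_prop) (fun y hy => ?_) (fun z hz y hy => ?_) fun z hz y hy => ?_
  · rw [abs_of_nonneg (by positivity)]
    refine rpow_le_rpow (abs_nonneg _) ?_ (by linarith)
    rw [abs_of_pos (by linarith [hy.2])]
    linarith [hy.1]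
  · have := hpos z hz y hy
    have : 0 ≤ (z - y) ^ (β - 2) := rpow_nonneg (by linarith) _
    rw [abs_of_nonneg (mul_nonneg (by linarith) this)]
    exact mul_le_mul_of_nonneg_left
      (rpow_le_rpow_of_nonpos (by linarith) (hpos z hz y hy) (by linarith)) (by linarith)
  · have hzy : 0 < z - y := by linarith [hpos z hz y hy]
    have h := hasDerivAt_rpow_const (x := z - y) (p := β - 1) (Or.inl hzy.ne')
    rw [show β - 1 - 1 = β - 2 by ring] at h
    refine h.congr_of_eventuallyEq ?_
    filter_upwards [lt_mem_nhds hzy] with u hu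
    rw [abs_of_pos hu]

lemma continuous_setIntegral_abs_sub_rpow {β : ℝ} (hβ1 : 1 < β) (hβ2 : β < 2) :
    Continuous fun x => ∫ y in Ioo (-1 : ℝ) 1, |x - y| ^ (β - 1) * (1 - y ^ 2) ^ (-β / 2) := by
  refine continuous_iff_continuousAt.2 fun x => continuousAt_of_dominated
    (bound := fun y => (|x| + 2) ^ (β - 1) * (1 - y ^ 2) ^ (-β / 2))
    (.of_forall fun z => Measurable.aestronglyMeasurable (by fun_prop)) ?_
    ((integrableOn_one_sub_sq_rpow (by linarith) (by linarith)).const_mul _) ?_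
  · filter_upwards [Metric.ball_mem_nhds x one_pos] with z hz
    refine (ae_restrict_iff' measurableSet_Ioo).2 (.of_forall fun y hy => ?_)
    have hP : 0 ≤ 1 - y ^ 2 := by nlinarith [hy.1, hy.2]
    rw [norm_of_nonneg (mul_nonneg (by positivity) (rpow_nonneg hP _))]
    refine mul_le_mul_of_nonneg_right (rpow_le_rpow (abs_nonneg _) ?_ (by linarith))
      (rpow_nonneg hP _)
    rw [Metric.mem_ball, dist_eq] at hz
    have hy : |y| < 1 := abs_lt.2 hy
    have : |z - y| ≤ |z| + |y| := abs_sub z y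
    have : |z| - |x| ≤ |z - x| := abs_sub_abs_le_abs_sub z x
    linarith
  · refine .of_forall fun y => ContinuousAt.mul_const ?_ _
    exact (by fun_prop : Continuous fun z : ℝ => |z - y|).continuousAt.rpow_const
      (Or.inr (by linarith))

lemma setIntegral_abs_sub_rpow_mul_one_sub_sq_rpow {β x : ℝ} (hβ1 : 1 < β) (hβ2 : β < 2)
    (hx : x ∈ Icc (-1) 1) :
    ∫ y in Ioo (-1 : ℝ) 1, |x - y| ^ (β - 1) * (1 - y ^ 2) ^ (-β / 2) =
      π / sin (β * π / 2) := by
  rw [← closure_Ioo (by norm_num)] at hx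
  exact closure_minimal
    (fun z hz => setIntegral_abs_sub_rpow_mul_one_sub_sq_rpow_of_abs_lt_one hβ1 hβ2 (abs_lt.2 hz))
    (isClosed_eq (continuous_setIntegral_abs_sub_rpow hβ1 hβ2) continuous_const) hx

lemma setIntegral_mul_abs_sub_rpow_neg (β x : ℝ) :
    ∫ y in Ioo (-1 : ℝ) 1, (-x - y) * |-x - y| ^ (β - 1) * (1 - y ^ 2) ^ (-β / 2) =
      -∫ y in Ioo (-1 : ℝ) 1, (x - y) * |x - y| ^ (β - 1) * (1 - y ^ 2) ^ (-β / 2) := by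
  simp only [← integral_Ioc_eq_integral_Ioo]
  rw [← intervalIntegral.integral_of_le (by norm_num),
    ← intervalIntegral.integral_of_le (by norm_num), ← intervalIntegral.integral_neg]
  have := intervalIntegral.integral_comp_neg (a := -1) (b := 1)
    fun y => (-x - y) * |-x - y| ^ (β - 1) * (1 - y ^ 2) ^ (-β / 2)
  rw [neg_neg] at this
  rw [← this]
  congr with y
  rw [show -x - -y = -(x - y) by ring, abs_neg, neg_mul, neg_mul, neg_sq]

lemma setIntegral_mul_abs_sub_rpow_of_mem_Icc {β x : ℝ} (hβ1 : 1 < β) (hβ2 : β < 2)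
    (hx : x ∈ Icc (0 : ℝ) 1) :
    ∫ y in Ioo (-1 : ℝ) 1, (x - y) * |x - y| ^ (β - 1) * (1 - y ^ 2) ^ (-β / 2) =
      β * (π / sin (β * π / 2)) * x := by
  have hzero := setIntegral_mul_abs_sub_rpow_neg β 0
  rw [neg_zero] at hzero
  have h := intervalIntegral.integral_eq_sub_of_hasDerivAt_of_le hx.1
    (fun z _ => (hasDerivAt_setIntegral_mul_abs_sub_rpow hβ1 hβ2 z).continuousAt.continuousWithinAt)
    (fun z _ => hasDerivAt_setIntegral_mul_abs_sub_rpow hβ1 hβ2 z)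
    (((continuous_setIntegral_abs_sub_rpow hβ1 hβ2).const_mul β).intervalIntegrable _ _)
  have hconst : ∫ z in (0 : ℝ)..x,
      β * ∫ y in Ioo (-1 : ℝ) 1, |z - y| ^ (β - 1) * (1 - y ^ 2) ^ (-β / 2) =
      ∫ z in (0 : ℝ)..x, β * (π / sin (β * π / 2)) := by
    refine intervalIntegral.integral_congr fun z hz => ?_
    rw [uIcc_of_le hx.1] at hz
    rw [setIntegral_abs_sub_rpow_mul_one_sub_sq_rpow hβ1 hβ2
      ⟨by linarith [hz.1], hz.2.trans hx.2⟩]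
  rw [hconst, intervalIntegral.integral_const, smul_eq_mul] at h
  linarith

lemma setIntegral_mul_abs_sub_rpow_of_one_lt {β x : ℝ} (hβ1 : 1 < β) (hβ2 : β < 2)
    (hx : 1 < x) :
    ∫ y in Ioo (-1 : ℝ) 1, (x - y) * |x - y| ^ (β - 1) * (1 - y ^ 2) ^ (-β / 2) =
      β * (π / sin (β * π / 2)) * x +
        β * (β - 1) * (√π * Gamma ((2 - β) / 2) / Gamma ((3 - β) / 2)) *
          ∫ z in (1 : ℝ)..x, (z ^ 2 - 1) ^ (-(2 - β) / 2) * (x - z) := by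
  set F : ℝ → ℝ := fun z => ∫ y in Ioo (-1 : ℝ) 1,
    (z - y) * |z - y| ^ (β - 1) * (1 - y ^ 2) ^ (-β / 2) with hF
  set G : ℝ → ℝ := fun z => ∫ y in Ioo (-1 : ℝ) 1,
    |z - y| ^ (β - 1) * (1 - y ^ 2) ^ (-β / 2) with hG
  have hF1 : F 1 = β * (π / sin (β * π / 2)) * 1 :=
    setIntegral_mul_abs_sub_rpow_of_mem_Icc hβ1 hβ2 (by norm_num)
  have hG1 : G 1 = π / sin (β * π / 2) :=
    setIntegral_abs_sub_rpow_mul_one_sub_sq_rpow hβ1 hβ2 (by norm_num)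
  have hF' : ∀ z, HasDerivAt F (β * G z) z := hasDerivAt_setIntegral_mul_abs_sub_rpow hβ1 hβ2
  have hcont : Continuous F := continuous_iff_continuousAt.2 fun z => (hF' z).continuousAt
  set C := √π * Gamma ((2 - β) / 2) / Gamma ((3 - β) / 2) with hC
  have hC0 : 0 ≤ C := by
    have := Gamma_nonneg_of_nonneg (s := (2 - β) / 2) (by linarith)
    have := Gamma_nonneg_of_nonneg (s := (3 - β) / 2) (by linarith)
    positivity
  have hderiv : ∀ z ∈ Ioo 1 x, HasDerivAt (fun z => β * G z * (x - z) + F z)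
      (β * (β - 1) * C * ((z ^ 2 - 1) ^ (-(2 - β) / 2) * (x - z))) z := by
    intro z hz
    have hG' : HasDerivAt G ((β - 1) * ((z ^ 2 - 1) ^ (-(2 - β) / 2) * C)) z := by
      rw [hC, ← setIntegral_one_sub_sq_rpow hβ2,
        ← setIntegral_sub_rpow_mul_one_sub_sq_rpow hz.1]
      exact hasDerivAt_setIntegral_abs_sub_rpow hβ1 hβ2 hz.1
    convert! ((hG'.const_mul β).mul ((hasDerivAt_id z).const_sub x)).add (hF' z) using 1
    simp only [id]
    ring
  have hcontOn : ContinuousOn (fun z => β * G z * (x - z) + F z) (Icc 1 x) := by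
    have := continuous_setIntegral_abs_sub_rpow hβ1 hβ2
    fun_prop
  have hint := intervalIntegral.integrableOn_deriv_of_nonneg hcontOn hderiv fun z hz => by
    have : 0 ≤ (z ^ 2 - 1) ^ (-(2 - β) / 2) := rpow_nonneg (by nlinarith [hz.1]) _
    have : 0 ≤ x - z := by linarith [hz.2]
    have : 0 ≤ β - 1 := by linarith
    positivity
  have h := intervalIntegral.integral_eq_sub_of_hasDerivAt_of_le hx.le hcontOn hderiv
    ((intervalIntegrable_iff_integrableOn_Ioc_of_le hx.le).2 hint)
  rw [intervalIntegral.integral_const_mul] at h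
  rw [h, hF1, hG1]
  ring

/-- equation (2.6). For `2 < α < 3` and `x ∈ ℝ` with `|x| ≠ 1`,
`∫_{-1}^{1} sgn(x-y) |x-y|^{α-1} (1-y²)^{-(α-1)/2} dy` equals `(α-1) c_α x` if `|x| < 1` and
equals `(α-1) c_α x + (α-1)(α-2) C_α sgn(x) ∫_1^{|x|} (z²-1)^{-(3-α)/2} (|x|-z) dz` if
`|x| > 1`. -/
theorem integral_sign_abs_rpow_sub_one
    (α : ℝ) (hα2 : 2 < α) (hα3 : α < 3)
    (Cα cα : ℝ)
    (hC : Cα = Real.sqrt π * Real.Gamma ((3 - α) / 2) / Real.Gamma ((4 - α) / 2))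
    (hc : cα = π / Real.sin ((α - 1) * π / 2)) :
    ∀ x : ℝ, |x| ≠ 1 →
      (∫ y in (-1 : ℝ)..1,
          Real.sign (x - y) * |x - y| ^ (α - 1) * (1 - y ^ 2) ^ (-(α - 1) / 2)) =
        if |x| < 1 then (α - 1) * cα * x
        else (α - 1) * cα * x + (α - 1) * (α - 2) * Cα * Real.sign x *
          ∫ z in (1 : ℝ)..|x|, (z ^ 2 - 1) ^ (-(3 - α) / 2) * (|x| - z) := by
  intro x hx
  obtain ⟨β, rfl⟩ : ∃ β, α = β + 1 := ⟨α - 1, by ring⟩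
  have hβ1 : 1 < β := by linarith
  have hβ2 : β < 2 := by linarith
  rw [intervalIntegral.integral_of_le (by norm_num), integral_Ioc_eq_integral_Ioo]
  simp only [add_sub_cancel_right, sign_mul_abs_rpow (by linarith : β ≠ 0)] at hc ⊢
  rw [show (3 - (β + 1)) = 2 - β by ring, show (4 - (β + 1)) = 3 - β by ring] at hC
  rw [show (3 - (β + 1)) = 2 - β by ring, show β + 1 - 2 = β - 1 by ring, hC, hc]
  split_ifs with hx1
  · obtain ⟨hl, hr⟩ := abs_lt.1 hx1
    rcases le_total 0 x with h0 | h0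
    · exact setIntegral_mul_abs_sub_rpow_of_mem_Icc hβ1 hβ2 ⟨h0, hr.le⟩
    · have h := setIntegral_mul_abs_sub_rpow_neg β (-x)
      rw [neg_neg, setIntegral_mul_abs_sub_rpow_of_mem_Icc (x := -x) hβ1 hβ2
        ⟨by linarith, by linarith⟩] at h
      rw [h]
      ring
  · have hx1 : 1 < |x| := lt_of_le_of_ne (not_lt.1 hx1) hx.symm
    rcases le_total 0 x with h0 | h0
    · rw [abs_of_nonneg h0] at hx1 ⊢
      rw [setIntegral_mul_abs_sub_rpow_of_one_lt hβ1 hβ2 hx1, sign_of_pos (by linarith), mul_one]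
    · rw [abs_of_nonpos h0] at hx1 ⊢
      have h := setIntegral_mul_abs_sub_rpow_neg β (-x)
      rw [neg_neg, setIntegral_mul_abs_sub_rpow_of_one_lt (x := -x) hβ1 hβ2 hx1] at h
      rw [h, sign_of_neg (by linarith)]
      ring
end
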